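/- arXiv:1309.1564 — 2 statements merged into one kernel-verified Lean document; each statement's English description precedes it below -/
import Mathlib

section
/- Let A be an m×n integer matrix with rows A_1,…,A_m ∈ ℤⁿ, let c ∈ ℂ^m, fix i ∈ {1,…,n} and j ∈ {1,…,m}, and suppose the i-th entry A_{j,i} of the row A_j satisfies A_{j,i} > 0. Then for every holomorphic function f on an open set U ⊆ {x ∈ ℂⁿ : x_1⋯x_n ≠ 0} one has the operator identity (⟨A_j, θ⟩ + c_j − 1)(H_i(A, c − e_j) f) = H_i(A, c)((⟨A_j, θ⟩ + c_j − 1) f) on U, where H_i(A,c) f := x_i P_i(θ)f − Q_i(θ)f is the i-th Horn operator and e_j ∈ ℂ^m is the j-th standard basis vector. -/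
open scoped BigOperators

/-- The operator `θ_k = x_k ∂/∂x_k` acting on functions of `n` complex variables. -/
noncomputable def th {n : ℕ} (k : Fin n) (f : (Fin n → ℂ) → ℂ) : (Fin n → ℂ) → ℂ :=
  fun x => x k * fderiv ℂ f x (Pi.single k 1)

/-- The first-order operator `⟨a, θ⟩ + c`. -/
noncomputable def linFactor {n : ℕ} (a : Fin n → ℤ) (c : ℂ) (f : (Fin n → ℂ) → ℂ) :
    (Fin n → ℂ) → ℂ :=
  fun x => (∑ k, (a k : ℂ) * th k f x) + c * f x

/-- The operator `∏_{ℓ=0}^{N-1} (⟨a, θ⟩ + c + ℓ)` (the factors commute). -/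
noncomputable def factorPow {n : ℕ} (a : Fin n → ℤ) (c : ℂ) :
    ℕ → ((Fin n → ℂ) → ℂ) → ((Fin n → ℂ) → ℂ)
  | 0 => id
  | N + 1 => fun f => linFactor a (c + N) (factorPow a c N f)

/-- The operator `P_k(θ)` of the Horn system `Horn(A, c)`. -/
noncomputable def Pop {m n : ℕ} (A : Fin m → Fin n → ℤ) (c : Fin m → ℂ) (k : Fin n)
    (f : (Fin n → ℂ) → ℂ) : (Fin n → ℂ) → ℂ :=
  (List.finRange m).foldr
    (fun i g => if 0 < A i k then factorPow (A i) (c i) (A i k).toNat g else g) f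

/-- The operator `Q_k(θ)` of the Horn system `Horn(A, c)`. -/
noncomputable def Qop {m n : ℕ} (A : Fin m → Fin n → ℤ) (c : Fin m → ℂ) (k : Fin n)
    (f : (Fin n → ℂ) → ℂ) : (Fin n → ℂ) → ℂ :=
  (List.finRange m).foldr
    (fun i g => if A i k < 0 then factorPow (A i) (c i) (A i k).natAbs g else g) f

/-- The `i`-th Horn operator `H_i(A,c) f = x_i P_i(θ) f - Q_i(θ) f`. -/
noncomputable def Hop {m n : ℕ} (A : Fin m → Fin n → ℤ) (c : Fin m → ℂ) (i : Fin n)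
    (f : (Fin n → ℂ) → ℂ) : (Fin n → ℂ) → ℂ :=
  fun x => x i * Pop A c i f x - Qop A c i f x

/-- The composition of the first-order operators `⟨a, θ⟩ + c` for the pairs `(a, c)` in a list. -/
noncomputable def applyFactors {n : ℕ} (l : List ((Fin n → ℤ) × ℂ)) (f : (Fin n → ℂ) → ℂ) :
    (Fin n → ℂ) → ℂ :=
  l.foldr (fun p g => linFactor p.1 p.2 g) f

/-- The factors `⟨a, θ⟩ + c + ℓ`, `ℓ = N - 1, …, 0`, in the order of `factorPow`. -/
noncomputable def factorList {n : ℕ} (a : Fin n → ℤ) (c : ℂ) : ℕ → List ((Fin n → ℤ) × ℂ)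
  | 0 => []
  | N + 1 => (a, c + N) :: factorList a c N

/-- The linear vector field `x ↦ (a_k x_k)_k`. -/
noncomputable def scaleField {n : ℕ} (a : Fin n → ℤ) : (Fin n → ℂ) →L[ℂ] (Fin n → ℂ) :=
  ContinuousLinearMap.pi fun k => (a k : ℂ) • ContinuousLinearMap.proj k

lemma scaleField_apply {n : ℕ} (a : Fin n → ℤ) (x : Fin n → ℂ) (k : Fin n) :
    scaleField a x k = a k * x k := by
  simp [scaleField]

lemma scaleField_comm {n : ℕ} (a b : Fin n → ℤ) (x : Fin n → ℂ) :
    scaleField a (scaleField b x) = scaleField b (scaleField a x) := by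
  ext k
  simp only [scaleField_apply]
  ring

lemma linFactor_apply {n : ℕ} (a : Fin n → ℤ) (c : ℂ) (f : (Fin n → ℂ) → ℂ) (x : Fin n → ℂ) :
    linFactor a c f x = fderiv ℂ f x (scaleField a x) + c * f x := by
  have h : scaleField a x = ∑ k, (a k * x k : ℂ) • Pi.single k (1 : ℂ) := by
    rw [pi_eq_sum_univ' (scaleField a x)]
    refine Finset.sum_congr rfl fun k _ => ?_
    rw [scaleField_apply]
  rw [h, map_sum]
  simp only [linFactor, th, map_smul, smul_eq_mul, mul_assoc]

lemma linFactor_eqOn {n : ℕ} {U : Set (Fin n → ℂ)} (hU : IsOpen U) {f g : (Fin n → ℂ) → ℂ}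
    (h : Set.EqOn f g U) (a : Fin n → ℤ) (c : ℂ) :
    Set.EqOn (linFactor a c f) (linFactor a c g) U := by
  intro x hx
  rw [linFactor_apply, linFactor_apply, h hx,
    (h.eventuallyEq_of_mem (hU.mem_nhds hx)).fderiv_eq]

lemma AnalyticOnNhd.linFactor {n : ℕ} {U : Set (Fin n → ℂ)} {f : (Fin n → ℂ) → ℂ}
    (hf : AnalyticOnNhd ℂ f U) (a : Fin n → ℤ) (c : ℂ) :
    AnalyticOnNhd ℂ (linFactor a c f) U := by
  have h : _root_.linFactor a c f = fun x => fderiv ℂ f x (scaleField a x) + c * f x :=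
    funext (linFactor_apply a c f)
  rw [h]
  intro x hx
  exact ((((ContinuousLinearMap.apply ℂ ℂ).flip.analyticAt_bilinear _).comp₂
    (hf.fderiv x hx) ((scaleField a).analyticAt x))).add
    (analyticAt_const.mul (hf x hx))

lemma linFactor_linFactor_apply {n : ℕ} {f : (Fin n → ℂ) → ℂ} {x : Fin n → ℂ}
    (hf : AnalyticAt ℂ f x) (a b : Fin n → ℤ) (c d : ℂ) :
    linFactor b d (linFactor a c f) x =
      fderiv ℂ (fderiv ℂ f) x (scaleField b x) (scaleField a x)
        + fderiv ℂ f x (scaleField a (scaleField b x)) + c * fderiv ℂ f x (scaleField b x)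
        + d * (fderiv ℂ f x (scaleField a x) + c * f x) := by
  have h : linFactor a c f = fun x => fderiv ℂ f x (scaleField a x) + c * f x :=
    funext (linFactor_apply a c f)
  have hd := (hf.fderiv.differentiableAt.hasFDerivAt.clm_apply
    (scaleField a).hasFDerivAt).add (hf.differentiableAt.hasFDerivAt.const_mul c)
  rw [linFactor_apply, h]
  have hd' : fderiv ℂ (fun x => fderiv ℂ f x (scaleField a x) + c * f x) x = _ := hd.fderiv
  rw [hd']
  simp
  ring

lemma linFactor_comm {n : ℕ} {f : (Fin n → ℂ) → ℂ} {x : Fin n → ℂ}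
    (hf : AnalyticAt ℂ f x) (a b : Fin n → ℤ) (c d : ℂ) :
    linFactor b d (linFactor a c f) x = linFactor a c (linFactor b d f) x := by
  have hs : IsSymmSndFDerivAt ℂ f x :=
    (hf.contDiffAt (n := ⊤)).isSymmSndFDerivAt le_top
  rw [linFactor_linFactor_apply hf, linFactor_linFactor_apply hf, scaleField_comm a b,
    hs (scaleField b x) (scaleField a x)]
  ring

lemma AnalyticOnNhd.applyFactors {n : ℕ} {U : Set (Fin n → ℂ)} {f : (Fin n → ℂ) → ℂ}
    (hf : AnalyticOnNhd ℂ f U) (l : List ((Fin n → ℤ) × ℂ)) :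
    AnalyticOnNhd ℂ (applyFactors l f) U := by
  induction l with
  | nil => exact hf
  | cons p l ih => exact ih.linFactor p.1 p.2

lemma applyFactors_append {n : ℕ} (l l' : List ((Fin n → ℤ) × ℂ)) (f : (Fin n → ℂ) → ℂ) :
    applyFactors (l ++ l') f = applyFactors l (applyFactors l' f) :=
  List.foldr_append

lemma applyFactors_eqOn_of_perm {n : ℕ} {U : Set (Fin n → ℂ)} (hU : IsOpen U)
    {f : (Fin n → ℂ) → ℂ} (hf : AnalyticOnNhd ℂ f U) {l l' : List ((Fin n → ℤ) × ℂ)}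
    (h : l.Perm l') : Set.EqOn (applyFactors l f) (applyFactors l' f) U := by
  induction h with
  | nil => exact Set.eqOn_refl _ _
  | cons p _ ih => exact linFactor_eqOn hU ih p.1 p.2
  | swap p q l => exact fun x hx => linFactor_comm (hf.applyFactors l x hx) _ _ _ _
  | trans _ _ ih ih' => exact ih.trans ih'

lemma factorPow_eq_applyFactors {n : ℕ} (a : Fin n → ℤ) (c : ℂ) (N : ℕ)
    (f : (Fin n → ℂ) → ℂ) : factorPow a c N f = applyFactors (factorList a c N) f := by
  induction N with
  | zero => rfl
  | succ N ih => exact congrArg (linFactor a (c + N)) ih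

lemma factorList_sub_one_succ {n : ℕ} (a : Fin n → ℤ) (c : ℂ) (N : ℕ) :
    factorList a (c - 1) (N + 1) = factorList a c N ++ [(a, c - 1)] := by
  induction N with
  | zero => simp [factorList]
  | succ N ih =>
    rw [factorList, ih, factorList, List.cons_append]
    congr 2
    push_cast
    ring

lemma foldr_applyFactors {n : ℕ} {ι : Type*} (l : List ι) (F : ι → List ((Fin n → ℤ) × ℂ))
    (f : (Fin n → ℂ) → ℂ) :
    l.foldr (fun t g => applyFactors (F t) g) f = applyFactors (l.flatMap F) f := by
  induction l with
  | nil => rfl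
  | cons t l ih => rw [List.foldr_cons, ih, List.flatMap_cons, applyFactors_append]

/-- The linear factors of `P_k`. -/
noncomputable def PopFactors {m n : ℕ} (A : Fin m → Fin n → ℤ) (c : Fin m → ℂ) (k : Fin n)
    (t : Fin m) : List ((Fin n → ℤ) × ℂ) :=
  if 0 < A t k then factorList (A t) (c t) (A t k).toNat else []

/-- The linear factors of `Q_k`. -/
noncomputable def QopFactors {m n : ℕ} (A : Fin m → Fin n → ℤ) (c : Fin m → ℂ) (k : Fin n)
    (t : Fin m) : List ((Fin n → ℤ) × ℂ) :=
  if A t k < 0 then factorList (A t) (c t) (A t k).natAbs else []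

lemma Pop_eq_applyFactors {m n : ℕ} (A : Fin m → Fin n → ℤ) (c : Fin m → ℂ) (k : Fin n)
    (f : (Fin n → ℂ) → ℂ) :
    Pop A c k f = applyFactors ((List.finRange m).flatMap (PopFactors A c k)) f := by
  rw [← foldr_applyFactors, Pop]
  congr 1
  funext t g
  unfold PopFactors
  split_ifs
  · exact factorPow_eq_applyFactors _ _ _ _
  · rfl

lemma Qop_eq_applyFactors {m n : ℕ} (A : Fin m → Fin n → ℤ) (c : Fin m → ℂ) (k : Fin n)
    (f : (Fin n → ℂ) → ℂ) :
    Qop A c k f = applyFactors ((List.finRange m).flatMap (QopFactors A c k)) f := by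
  rw [← foldr_applyFactors, Qop]
  congr 1
  funext t g
  unfold QopFactors
  split_ifs
  · exact factorPow_eq_applyFactors _ _ _ _
  · rfl

lemma cons_flatMap_perm_flatMap_append {ι α : Type*} [DecidableEq ι] {l : List ι}
    (hl : l.Nodup) {j : ι} (hj : j ∈ l) {F G : ι → List α} (hFG : ∀ t ≠ j, F t = G t) {p q : α}
    (h : p :: F j = G j ++ [q]) : (p :: l.flatMap F).Perm (l.flatMap G ++ [q]) := by
  have hp := List.perm_cons_erase hj
  have he : (l.erase j).flatMap F = (l.erase j).flatMap G := by
    refine List.flatMap_congr fun t ht => hFG t ?_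
    rintro rfl
    exact hl.not_mem_erase ht
  refine ((hp.flatMap_right F).cons p).trans
    (List.Perm.trans ?_ ((hp.flatMap_right G).symm.append_right [q]))
  rw [List.flatMap_cons, List.flatMap_cons, he, ← List.cons_append, h, List.append_assoc,
    List.append_assoc]
  exact List.perm_append_comm.append_left _

lemma linFactor_coord_mul_sub {n : ℕ} {g h : (Fin n → ℂ) → ℂ} {x : Fin n → ℂ}
    (hg : DifferentiableAt ℂ g x) (hh : DifferentiableAt ℂ h x) (a : Fin n → ℤ) (c : ℂ)
    (i : Fin n) :
    linFactor a c (fun y => y i * g y - h y) x =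
      x i * linFactor a (c + a i) g x - linFactor a c h x := by
  have hd := (((ContinuousLinearMap.proj (R := ℂ) (φ := fun _ : Fin n => ℂ) i).hasFDerivAt
    (x := x)).mul hg.hasFDerivAt).sub hh.hasFDerivAt
  have hd' : fderiv ℂ (fun y => y i * g y - h y) x = _ := hd.fderiv
  simp only [linFactor_apply, hd']
  simp [scaleField_apply]
  ring

/-- Operator identity behind the intertwining operators of Horn systems, in the case
`A_{j,i} > 0`:  `(⟨A_j, θ⟩ + c_j - 1)(H_i(A, c - e_j) f)
  = H_i(A, c)((⟨A_j, θ⟩ + c_j - 1) f)` on `U`. -/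
theorem stmt2 {m n : ℕ} (A : Fin m → Fin n → ℤ) (c : Fin m → ℂ) (i : Fin n) (j : Fin m)
    (hA : 0 < A j i)
    (U : Set (Fin n → ℂ)) (hUopen : IsOpen U) (hU : U ⊆ {x | (∏ k, x k) ≠ 0})
    (f : (Fin n → ℂ) → ℂ) (hf : AnalyticOnNhd ℂ f U) :
    ∀ x ∈ U,
      (∑ k, (A j k : ℂ) * th k (Hop A (c - Pi.single j 1) i f) x)
          + (c j - 1) * Hop A (c - Pi.single j 1) i f x
        = Hop A c i (fun y => (∑ k, (A j k : ℂ) * th k f y) + (c j - 1) * f y) x := by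
  intro x hx
  change linFactor (A j) (c j - 1) (Hop A (c - Pi.single j 1) i f) x
    = Hop A c i (linFactor (A j) (c j - 1) f) x
  unfold Hop
  simp only [Pop_eq_applyFactors, Qop_eq_applyFactors]
  rw [linFactor_coord_mul_sub (hf.applyFactors _ x hx).differentiableAt
    (hf.applyFactors _ x hx).differentiableAt]
  have hc : ∀ t ≠ j, (c - Pi.single j 1 : Fin m → ℂ) t = c t := fun t ht => by simp [ht]
  have hcj : (c - Pi.single j 1 : Fin m → ℂ) j = c j - 1 := by simp
  have hcast : ((A j i).toNat : ℂ) = A j i := by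
    exact_mod_cast congrArg (Int.cast : ℤ → ℂ) (Int.toNat_of_nonneg hA.le)
  have hP : (((A j, c j - 1 + A j i) :: (List.finRange m).flatMap
      (PopFactors A (c - Pi.single j 1) i))).Perm
      ((List.finRange m).flatMap (PopFactors A c i) ++ [(A j, c j - 1)]) := by
    refine cons_flatMap_perm_flatMap_append (List.nodup_finRange m) (List.mem_finRange j)
      (fun t ht => by rw [PopFactors, PopFactors, hc t ht]) ?_
    rw [PopFactors, PopFactors, if_pos hA, if_pos hA, hcj, ← hcast, ← factorList_sub_one_succ,
      factorList]
  have hQf : QopFactors A (c - Pi.single j 1) i = QopFactors A c i := by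
    funext t
    by_cases ht : t = j
    · subst ht
      rw [QopFactors, QopFactors, if_neg hA.not_gt, if_neg hA.not_gt]
    · rw [QopFactors, QopFactors, hc t ht]
  have hP' := applyFactors_eqOn_of_perm hUopen hf hP hx
  have hQ' := applyFactors_eqOn_of_perm hUopen hf
    (List.perm_append_comm (l₁ := [(A j, c j - 1)])
      (l₂ := (List.finRange m).flatMap (QopFactors A c i))) hx
  rw [applyFactors_append] at hP' hQ'
  rw [applyFactors_append] at hQ'
  rw [hQf]
  exact congrArg₂ (fun u v => x i * u - v) hP' hQ'
end

section
/- Consider the Horn system generated by the two operators T_1 = x_1(θ_1 + θ_2 − 3)(θ_1 − 2θ_2 − 1) − (−2θ_1 + θ_2)(−2θ_1 + θ_2 − 1) and T_2 = x_2(θ_1 + θ_2 − 3)(−2θ_1 + θ_2 − 1) − (θ_1 − 2θ_2)(θ_1 − 2θ_2 − 1). Both of the functions f(x) = 1/(x_1 x_2) and f_0(x) = (x_1^{2/3} x_2^{1/3} + x_1^{1/3} x_2^{2/3} + 1)^5 / (x_1 x_2) (principal branches) satisfy T_1 f = 0 and T_2 f = 0 on (ℂ∖(−∞,0])². (The persistent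 Laurent monomial solution and the generating Puiseux polynomial solution f_0 of the simplicial Horn system defined by the normals (1,1), (1,−2), (−2,1).) -/
open scoped BigOperators

/-- The operator `θ₁ = x₁ ∂/∂x₁` acting on functions of two complex variables. -/
noncomputable def th1 (f : ℂ × ℂ → ℂ) : ℂ × ℂ → ℂ := fun p => p.1 * fderiv ℂ f p (1, 0)

/-- The operator `θ₂ = x₂ ∂/∂x₂` acting on functions of two complex variables. -/
noncomputable def th2 (f : ℂ × ℂ → ℂ) : ℂ × ℂ → ℂ := fun p => p.2 * fderiv ℂ f p (0, 1)

/-- The first-order operator `a θ₁ + b θ₂ + c`. -/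
noncomputable def lin2 (a b c : ℂ) (f : ℂ × ℂ → ℂ) : ℂ × ℂ → ℂ :=
  fun p => a * th1 f p + b * th2 f p + c * f p

/-- The operator `∏_{ℓ=0}^{N-1} (a θ₁ + b θ₂ + c + ℓ)` (the factors commute). -/
noncomputable def linPow2 (a b c : ℂ) : ℕ → (ℂ × ℂ → ℂ) → (ℂ × ℂ → ℂ)
  | 0 => id
  | N + 1 => fun f => lin2 a b (c + N) (linPow2 a b c N f)

/-- The operator `T₁ = x₁(θ₁+θ₂-3)(θ₁-2θ₂-1) - (-2θ₁+θ₂)(-2θ₁+θ₂-1)`. -/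
noncomputable def T1 (f : ℂ × ℂ → ℂ) : ℂ × ℂ → ℂ :=
  fun p => p.1 * lin2 1 1 (-3) (lin2 1 (-2) (-1) f) p -
    lin2 (-2) 1 0 (lin2 (-2) 1 (-1) f) p

/-- The operator `T₂ = x₂(θ₁+θ₂-3)(-2θ₁+θ₂-1) - (θ₁-2θ₂)(θ₁-2θ₂-1)`. -/
noncomputable def T2 (f : ℂ × ℂ → ℂ) : ℂ × ℂ → ℂ :=
  fun p => p.2 * lin2 1 1 (-3) (lin2 (-2) 1 (-1) f) p -
    lin2 1 (-2) 0 (lin2 1 (-2) (-1) f) p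

/-- `f` is complex differentiable at `p` with `θ₁ f p = d₁` and `θ₂ f p = d₂`. -/
def HasEulerAt (f : ℂ × ℂ → ℂ) (p : ℂ × ℂ) (d₁ d₂ : ℂ) : Prop :=
  DifferentiableAt ℂ f p ∧ th1 f p = d₁ ∧ th2 f p = d₂

namespace HasEulerAt

variable {f g : ℂ × ℂ → ℂ} {p : ℂ × ℂ} {d₁ d₂ e₁ e₂ : ℂ}

theorem lin2_eq (h : HasEulerAt f p d₁ d₂) (a b c : ℂ) :
    lin2 a b c f p = a * d₁ + b * d₂ + c * f p := by
  rw [lin2, h.2.1, h.2.2]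

theorem const (c : ℂ) (p : ℂ × ℂ) : HasEulerAt (fun _ => c) p 0 0 := by
  refine ⟨by fun_prop, ?_, ?_⟩ <;> simp [th1, th2]

theorem add (hf : HasEulerAt f p d₁ d₂) (hg : HasEulerAt g p e₁ e₂) :
    HasEulerAt (fun q => f q + g q) p (d₁ + e₁) (d₂ + e₂) := by
  obtain ⟨hf, rfl, rfl⟩ := hf
  obtain ⟨hg, rfl, rfl⟩ := hg
  refine ⟨hf.add hg, ?_, ?_⟩ <;>
  · simp only [th1, th2, fderiv_fun_add hf hg,
      add_apply]
    ring

theorem mul (hf : HasEulerAt f p d₁ d₂) (hg : HasEulerAt g p e₁ e₂) :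
    HasEulerAt (fun q => f q * g q) p (d₁ * g p + f p * e₁) (d₂ * g p + f p * e₂) := by
  obtain ⟨hf, rfl, rfl⟩ := hf
  obtain ⟨hg, rfl, rfl⟩ := hg
  refine ⟨hf.mul hg, ?_, ?_⟩ <;>
  · simp only [th1, th2, fderiv_fun_mul hf hg,
      add_apply, smul_apply, smul_eq_mul]
    ring

theorem pow (hf : HasEulerAt f p d₁ d₂) (n : ℕ) :
    HasEulerAt (fun q => f q ^ n) p (n * f p ^ (n - 1) * d₁) (n * f p ^ (n - 1) * d₂) := by
  obtain ⟨hf, rfl, rfl⟩ := hf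
  refine ⟨hf.pow n, ?_, ?_⟩ <;>
  · simp only [th1, th2, fderiv_fun_pow n hf,
      smul_apply, smul_eq_mul, nsmul_eq_mul]
    ring

theorem comp_fst {φ : ℂ → ℂ} {φ' : ℂ} (h : HasDerivAt φ φ' p.1) :
    HasEulerAt (fun q => φ q.1) p (p.1 * φ') 0 := by
  have h' : HasFDerivAt (fun q : ℂ × ℂ => φ q.1) _ p :=
    h.comp_hasFDerivAt p (hasFDerivAt_fst (𝕜 := ℂ) (E := ℂ) (F := ℂ))
  refine ⟨h'.differentiableAt, ?_, ?_⟩ <;> simp [th1, th2, h'.fderiv]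

theorem comp_snd {φ : ℂ → ℂ} {φ' : ℂ} (h : HasDerivAt φ φ' p.2) :
    HasEulerAt (fun q => φ q.2) p 0 (p.2 * φ') := by
  have h' : HasFDerivAt (fun q : ℂ × ℂ => φ q.2) _ p :=
    h.comp_hasFDerivAt p (hasFDerivAt_snd (𝕜 := ℂ) (E := ℂ) (F := ℂ))
  refine ⟨h'.differentiableAt, ?_, ?_⟩ <;> simp [th1, th2, h'.fderiv]

end HasEulerAt

theorem mul_deriv_cpow {z : ℂ} (hz : z ∈ Complex.slitPlane) (w : ℂ) :
    z * (w * z ^ (w - 1)) = w * z ^ w := by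
  have hz0 := Complex.slitPlane_ne_zero hz
  rw [Complex.cpow_sub _ _ hz0, Complex.cpow_one]
  field_simp

theorem hasEulerAt_cpow_mul_cpow {p : ℂ × ℂ} (h₁ : p.1 ∈ Complex.slitPlane)
    (h₂ : p.2 ∈ Complex.slitPlane) (α β : ℂ) :
    HasEulerAt (fun q => q.1 ^ α * q.2 ^ β) p
      (α * (p.1 ^ α * p.2 ^ β)) (β * (p.1 ^ α * p.2 ^ β)) := by
  have hx : HasDerivAt (fun z : ℂ => z ^ α) (α * p.1 ^ (α - 1)) p.1 := by
    simpa using (hasDerivAt_id p.1).cpow_const (c := α) h₁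
  have hy : HasDerivAt (fun z : ℂ => z ^ β) (β * p.2 ^ (β - 1)) p.2 := by
    simpa using (hasDerivAt_id p.2).cpow_const (c := β) h₂
  convert (HasEulerAt.comp_fst hx).mul (HasEulerAt.comp_snd hy) using 1
  · rw [mul_deriv_cpow h₁]; ring
  · rw [mul_deriv_cpow h₂]; ring

theorem hasEulerAt_inv_mul_inv {p : ℂ × ℂ} (h₁ : p.1 ≠ 0) (h₂ : p.2 ≠ 0) :
    HasEulerAt (fun q => q.1⁻¹ * q.2⁻¹) p (-(p.1⁻¹ * p.2⁻¹)) (-(p.1⁻¹ * p.2⁻¹)) := by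
  convert (HasEulerAt.comp_fst (hasDerivAt_inv h₁)).mul
    (HasEulerAt.comp_snd (hasDerivAt_inv h₂)) using 1 <;> field_simp <;> ring

theorem lin2_congr {f g : ℂ × ℂ → ℂ} {p : ℂ × ℂ} (h : f =ᶠ[nhds p] g) (a b c : ℂ) :
    lin2 a b c f p = lin2 a b c g p := by
  simp only [lin2, th1, th2, h.fderiv_eq, h.eq_of_nhds]

/-- The product of the two slit planes. -/
def slitPlaneProd : Set (ℂ × ℂ) := Complex.slitPlane ×ˢ Complex.slitPlane

theorem lin2_lin2_of_eqOn {f g : ℂ × ℂ → ℂ} {a b c : ℂ}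
    (h : Set.EqOn (lin2 a b c f) g slitPlaneProd) {p : ℂ × ℂ} (hp : p ∈ slitPlaneProd)
    (a' b' c' : ℂ) : lin2 a' b' c' (lin2 a b c f) p = lin2 a' b' c' g p :=
  lin2_congr (h.eventuallyEq_of_mem
    ((Complex.isOpen_slitPlane.prod Complex.isOpen_slitPlane).mem_nhds hp)) _ _ _

/-- The Puiseux monomial `x₁^{2/3} x₂^{1/3}`. -/
noncomputable def puiseuxU (q : ℂ × ℂ) : ℂ := q.1 ^ ((2 : ℂ) / 3) * q.2 ^ ((1 : ℂ) / 3)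

/-- The Puiseux monomial `x₁^{1/3} x₂^{2/3}`. -/
noncomputable def puiseuxV (q : ℂ × ℂ) : ℂ := q.1 ^ ((1 : ℂ) / 3) * q.2 ^ ((2 : ℂ) / 3)

section

variable {p : ℂ × ℂ}

theorem puiseuxU_sq (hp : p ∈ slitPlaneProd) : puiseuxU p ^ 2 = p.1 * puiseuxV p := by
  have h₁ := Complex.slitPlane_ne_zero hp.1
  have h₂ := Complex.slitPlane_ne_zero hp.2
  have e₁ : p.1 ^ ((2 : ℂ) / 3) * p.1 ^ ((2 : ℂ) / 3) = p.1 * p.1 ^ ((1 : ℂ) / 3) := by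
    rw [← Complex.cpow_add _ _ h₁,
      show (2 : ℂ) / 3 + 2 / 3 = 1 + 1 / 3 by norm_num, Complex.cpow_add _ _ h₁, Complex.cpow_one]
  have e₂ : p.2 ^ ((1 : ℂ) / 3) * p.2 ^ ((1 : ℂ) / 3) = p.2 ^ ((2 : ℂ) / 3) := by
    rw [← Complex.cpow_add _ _ h₂]; norm_num
  rw [puiseuxU, puiseuxV, ← e₂]
  linear_combination (p.2 ^ ((1 : ℂ) / 3)) ^ 2 * e₁

theorem puiseuxV_sq (hp : p ∈ slitPlaneProd) : puiseuxV p ^ 2 = p.2 * puiseuxU p := by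
  have h : p.swap ∈ slitPlaneProd := ⟨hp.2, hp.1⟩
  have := puiseuxU_sq h
  simp only [puiseuxU, puiseuxV, Prod.fst_swap, Prod.snd_swap] at this ⊢
  linear_combination this

theorem hasEulerAt_puiseuxU (hp : p ∈ slitPlaneProd) :
    HasEulerAt puiseuxU p (2 / 3 * puiseuxU p) (1 / 3 * puiseuxU p) :=
  hasEulerAt_cpow_mul_cpow hp.1 hp.2 _ _

theorem hasEulerAt_puiseuxV (hp : p ∈ slitPlaneProd) :
    HasEulerAt puiseuxV p (1 / 3 * puiseuxV p) (2 / 3 * puiseuxV p) :=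
  hasEulerAt_cpow_mul_cpow hp.1 hp.2 _ _

theorem lin2_mul_pow (hp : p ∈ slitPlaneProd) {g : ℂ × ℂ → ℂ} {d₁ d₂ : ℂ}
    (hg : HasEulerAt g p d₁ d₂) (n : ℕ) (a b c : ℂ) :
    lin2 a b c (fun q => g q * (puiseuxU q + puiseuxV q + 1) ^ (n + 1) * (q.1⁻¹ * q.2⁻¹)) p =
      ((a * (d₁ - g p) + b * (d₂ - g p) + c * g p) * (puiseuxU p + puiseuxV p + 1) +
        (n + 1) * g p * (a * (2 / 3 * puiseuxU p + 1 / 3 * puiseuxV p) +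
          b * (1 / 3 * puiseuxU p + 2 / 3 * puiseuxV p))) *
      (puiseuxU p + puiseuxV p + 1) ^ n * (p.1⁻¹ * p.2⁻¹) := by
  have hs := ((hasEulerAt_puiseuxU hp).add (hasEulerAt_puiseuxV hp)).add (HasEulerAt.const 1 p)
  have hm := hasEulerAt_inv_mul_inv (Complex.slitPlane_ne_zero hp.1)
    (Complex.slitPlane_ne_zero hp.2)
  rw [((hg.mul (hs.pow (n + 1))).mul hm).lin2_eq]
  push_cast
  ring

end

/-- The persistent Laurent monomial solution `1/(x₁x₂)` and the generating Puiseux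
polynomial solution `f₀ = (x₁^{2/3}x₂^{1/3} + x₁^{1/3}x₂^{2/3} + 1)⁵/(x₁x₂)` of the
simplicial Horn system defined by the normals `(1,1), (1,-2), (-2,1)`. -/
theorem stmt19 :
    ∀ p : ℂ × ℂ, p.1 ∈ Complex.slitPlane → p.2 ∈ Complex.slitPlane →
      (T1 (fun q => 1 / (q.1 * q.2)) p = 0 ∧ T2 (fun q => 1 / (q.1 * q.2)) p = 0) ∧
      (T1 (fun q => (q.1 ^ ((2 : ℂ) / 3) * q.2 ^ ((1 : ℂ) / 3) +
          q.1 ^ ((1 : ℂ) / 3) * q.2 ^ ((2 : ℂ) / 3) + 1) ^ (5 : ℕ) / (q.1 * q.2)) p = 0 ∧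
        T2 (fun q => (q.1 ^ ((2 : ℂ) / 3) * q.2 ^ ((1 : ℂ) / 3) +
          q.1 ^ ((1 : ℂ) / 3) * q.2 ^ ((2 : ℂ) / 3) + 1) ^ (5 : ℕ) / (q.1 * q.2)) p = 0) := by
  intro p h₁ h₂
  have hp : p ∈ slitPlaneProd := ⟨h₁, h₂⟩
  have monomial_eq : (fun q : ℂ × ℂ => 1 / (q.1 * q.2)) = fun q => q.1⁻¹ * q.2⁻¹ := by
    funext q; rw [one_div, mul_inv]
  have puiseux_eq : (fun q : ℂ × ℂ => (q.1 ^ ((2 : ℂ) / 3) * q.2 ^ ((1 : ℂ) / 3) +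
      q.1 ^ ((1 : ℂ) / 3) * q.2 ^ ((2 : ℂ) / 3) + 1) ^ (5 : ℕ) / (q.1 * q.2)) =
      fun q => 1 * (puiseuxU q + puiseuxV q + 1) ^ (4 + 1) * (q.1⁻¹ * q.2⁻¹) := by
    funext q; rw [div_eq_mul_inv, mul_inv, one_mul]; rfl
  rw [monomial_eq, puiseux_eq]
  have lin2_monomial : ∀ a b c : ℂ, c = a + b →
      Set.EqOn (lin2 a b c fun q => q.1⁻¹ * q.2⁻¹) (fun _ => 0) slitPlaneProd := by
    rintro a b c rfl q hq
    rw [(hasEulerAt_inv_mul_inv (Complex.slitPlane_ne_zero hq.1)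
      (Complex.slitPlane_ne_zero hq.2)).lin2_eq]
    ring
  have lin2_puiseux_V : Set.EqOn (lin2 1 (-2) (-1)
      fun q => 1 * (puiseuxU q + puiseuxV q + 1) ^ (4 + 1) * (q.1⁻¹ * q.2⁻¹))
      (fun q => -5 * puiseuxV q * (puiseuxU q + puiseuxV q + 1) ^ (3 + 1) * (q.1⁻¹ * q.2⁻¹))
      slitPlaneProd := by
    intro q hq
    rw [lin2_mul_pow hq (HasEulerAt.const 1 q)]
    push_cast
    ring
  have lin2_puiseux_U : Set.EqOn (lin2 (-2) 1 (-1)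
      fun q => 1 * (puiseuxU q + puiseuxV q + 1) ^ (4 + 1) * (q.1⁻¹ * q.2⁻¹))
      (fun q => -5 * puiseuxU q * (puiseuxU q + puiseuxV q + 1) ^ (3 + 1) * (q.1⁻¹ * q.2⁻¹))
      slitPlaneProd := by
    intro q hq
    rw [lin2_mul_pow hq (HasEulerAt.const 1 q)]
    push_cast
    ring
  have hU := (HasEulerAt.const (-5) p).mul (hasEulerAt_puiseuxU hp)
  have hV := (HasEulerAt.const (-5) p).mul (hasEulerAt_puiseuxV hp)
  refine ⟨⟨?_, ?_⟩, ?_, ?_⟩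
  · rw [T1, lin2_lin2_of_eqOn (lin2_monomial _ _ _ (by norm_num)) hp,
      lin2_lin2_of_eqOn (lin2_monomial _ _ _ (by norm_num)) hp,
      (HasEulerAt.const 0 p).lin2_eq, (HasEulerAt.const 0 p).lin2_eq]
    ring
  · rw [T2, lin2_lin2_of_eqOn (lin2_monomial _ _ _ (by norm_num)) hp,
      lin2_lin2_of_eqOn (lin2_monomial _ _ _ (by norm_num)) hp,
      (HasEulerAt.const 0 p).lin2_eq, (HasEulerAt.const 0 p).lin2_eq]
    ring
  · rw [T1, lin2_lin2_of_eqOn lin2_puiseux_V hp, lin2_lin2_of_eqOn lin2_puiseux_U hp,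
      lin2_mul_pow hp hV, lin2_mul_pow hp hU]
    push_cast
    linear_combination (-20) * (puiseuxU p + puiseuxV p + 1) ^ 3 * (p.1⁻¹ * p.2⁻¹) *
      puiseuxU_sq hp
  · rw [T2, lin2_lin2_of_eqOn lin2_puiseux_U hp, lin2_lin2_of_eqOn lin2_puiseux_V hp,
      lin2_mul_pow hp hU, lin2_mul_pow hp hV]
    push_cast
    linear_combination (-20) * (puiseuxU p + puiseuxV p + 1) ^ 3 * (p.1⁻¹ * p.2⁻¹) *
      puiseuxV_sq hp
end
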